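/- arXiv:2212.14509 — 2 statements merged into one kernel-verified Lean document; each statement's English description precedes it below -/
import Mathlib

section
/- Under the assumptions of the one-dimensional toll problem (μ supported in (-M,0), ν supported in (0,M), toll at 0, r·t_f > 1), the minimizer π of ∫(x²/t + y²/(t_f−t))dπ subject to marginals μ, ν and t-marginal density ≤ r is unique, and has the form π = (T^x, T^y, Id)_# (σ dt) for non-increasing functions T^x, T^y and an absolutely continuous t-marginal density σ ≤ r. -/
open MeasureTheory ENNReal

lemma toll_quantile (ρ : Measure ℝ) [IsProbabilityMeasure ρ] (a b : ℝ) (hab : a ≤ b)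
    (h : ρ (Set.Icc a b)ᶜ = 0) :
    ∃ q : ℝ → ℝ, Monotone q ∧ (∀ u, q u ∈ Set.Icc a b) ∧
      (volume.restrict (Set.Ioo (0:ℝ) 1)).map q = ρ := by
  set F := ProbabilityTheory.cdf ρ with hF
  let S : ℝ → Set ℝ := fun u => {x | x ∈ Set.Icc a b ∧ (u ≤ F x ∨ x = b)}
  have hne : ∀ u, (S u).Nonempty := fun u => ⟨b, ⟨hab, le_rfl⟩, Or.inr rfl⟩
  have hbd : ∀ u, BddBelow (S u) := fun u => ⟨a, fun x hx => hx.1.1⟩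
  have hqm : Monotone (fun u => sInf (S u)) := by
    intro u v huv
    refine csInf_le_csInf (hbd u) (hne v) ?_
    rintro x ⟨hx, hx'⟩
    exact ⟨hx, hx'.imp (fun h => huv.trans h) id⟩
  have hqI : ∀ u, sInf (S u) ∈ Set.Icc a b := fun u =>
    ⟨le_csInf (hne u) fun x hx => hx.1.1, csInf_le (hbd u) ⟨⟨hab, le_rfl⟩, Or.inr rfl⟩⟩
  have hFlo : ∀ x, x < a → F x = 0 := by
    intro x hx
    have : ρ (Set.Iic x) = 0 := measure_mono_null (fun y hy => by
      simp only [Set.mem_compl_iff, Set.mem_Icc, not_and_or, not_le]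
      exact Or.inl (lt_of_le_of_lt hy hx)) h
    rw [hF, ProbabilityTheory.cdf_eq_real, measureReal_def, this]; simp
  have hFhi : ∀ x, b ≤ x → F x = 1 := by
    intro x hx
    have : ρ (Set.Iic x) = 1 := by
      rw [prob_compl_eq_zero_iff measurableSet_Icc] at h
      refine le_antisymm prob_le_one (h ▸ measure_mono fun y hy => hy.2.trans hx)
    rw [hF, ProbabilityTheory.cdf_eq_real, measureReal_def, this]; simp
  have hgal : ∀ u ∈ Set.Ioo (0:ℝ) 1, ∀ x, sInf (S u) ≤ x ↔ u ≤ F x := by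
    intro u hu x
    constructor
    · intro hx
      refine ge_of_tendsto ((F.right_continuous x).tendsto.mono_left
        (nhdsWithin_mono x Set.Ioi_subset_Ici_self)) ?_
      filter_upwards [self_mem_nhdsWithin] with y hy
      obtain ⟨z, hz, hzy⟩ := exists_lt_of_csInf_lt (hne u) (lt_of_le_of_lt hx hy)
      rcases hz.2 with h1 | h1
      · exact h1.trans (F.mono hzy.le)
      · rw [hFhi y (h1 ▸ hzy.le)]; exact hu.2.le
    · intro hx
      rcases lt_or_ge x a with h1 | h1
      · rw [hFlo x h1] at hx; exact absurd hx (not_le.2 hu.1)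
      rcases le_or_gt b x with h2 | h2
      · exact (hqI u).2.trans h2
      exact csInf_le (hbd u) ⟨⟨h1, h2.le⟩, Or.inl hx⟩
  refine ⟨fun u => sInf (S u), hqm, hqI, ?_⟩
  have : IsProbabilityMeasure (volume.restrict (Set.Ioo (0:ℝ) 1)) := ⟨by simp⟩
  have := Measure.isProbabilityMeasure_map (μ := volume.restrict (Set.Ioo (0:ℝ) 1))
    hqm.measurable.aemeasurable
  refine Measure.ext_of_Iic _ _ fun x => ?_
  rw [Measure.map_apply hqm.measurable measurableSet_Iic,
    Measure.restrict_apply (hqm.measurable measurableSet_Iic), ← ProbabilityTheory.ofReal_cdf]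
  have : ((fun u => sInf (S u)) ⁻¹' Set.Iic x ∩ Set.Ioo 0 1) = Set.Iic (F x) ∩ Set.Ioo 0 1 := by
    ext u
    constructor
    · rintro ⟨h1, h2⟩; exact ⟨(hgal u h2 x).1 h1, h2⟩
    · rintro ⟨h1, h2⟩; exact ⟨(hgal u h2 x).2 h1, h2⟩
  rw [this]
  have h1 : F x ≤ 1 := ProbabilityTheory.cdf_le_one ρ x
  refine le_antisymm ?_ ?_
  · calc volume (Set.Iic (F x) ∩ Set.Ioo 0 1) ≤ volume (Set.Ioc 0 (F x)) :=
          measure_mono fun u hu => ⟨hu.2.1, hu.1⟩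
      _ = _ := by simp [hF]
  · calc _ = volume (Set.Ioo 0 (F x)) := by simp [hF]
      _ ≤ volume (Set.Iic (F x) ∩ Set.Ioo 0 1) :=
          measure_mono fun u hu => ⟨hu.2.le, hu.1, hu.2.trans_le h1⟩

lemma toll_comono (A B : ℝ → ℝ) (hAm : Measurable A) (hBm : Measurable B)
    (hA : MonotoneOn A (Set.Ioo 0 1)) (hB : AntitoneOn B (Set.Ioo 0 1)) (s s' : ℝ) :
    (volume.restrict (Set.Ioo (0:ℝ) 1)) (A ⁻¹' Set.Ioi s ∩ B ⁻¹' Set.Ioi s') ≤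
      (volume.restrict (Set.Ioo (0:ℝ) 1)) (A ⁻¹' Set.Ioi s) +
      (volume.restrict (Set.Ioo (0:ℝ) 1)) (B ⁻¹' Set.Ioi s') - 1 := by
  have : IsProbabilityMeasure (volume.restrict (Set.Ioo (0:ℝ) 1)) := ⟨by simp⟩
  have hU : MeasurableSet (A ⁻¹' Set.Ioi s) := hAm measurableSet_Ioi
  have hL : MeasurableSet (B ⁻¹' Set.Ioi s') := hBm measurableSet_Ioi
  by_cases hex : ∃ u ∈ Set.Ioo (0:ℝ) 1, A u ≤ s ∧ B u ≤ s'
  · obtain ⟨u, hu, h1, h2⟩ := hex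
    have : (volume.restrict (Set.Ioo (0:ℝ) 1)) (A ⁻¹' Set.Ioi s ∩ B ⁻¹' Set.Ioi s') = 0 := by
      rw [Measure.restrict_apply (hU.inter hL)]
      convert measure_empty (μ := volume)
      ext v
      simp only [Set.mem_inter_iff, Set.mem_preimage, Set.mem_Ioi, Set.mem_empty_iff_false,
        iff_false]
      rintro ⟨⟨h3, h4⟩, hv⟩
      rcases le_total u v with h | h
      · exact absurd (hB hu hv h) (by linarith)
      · exact absurd (hA hv hu h) (by linarith)
    rw [this]; exact zero_le
  · push Not at hex
    rw [← measure_union_add_inter _ hL]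
    have : (volume.restrict (Set.Ioo (0:ℝ) 1)) (A ⁻¹' Set.Ioi s ∪ B ⁻¹' Set.Ioi s') = 1 := by
      rw [Measure.restrict_apply (hU.union hL)]
      have : (A ⁻¹' Set.Ioi s ∪ B ⁻¹' Set.Ioi s') ∩ Set.Ioo 0 1 = Set.Ioo (0:ℝ) 1 := by
        refine Set.inter_eq_right.2 fun u hu => ?_
        rcases le_or_gt (A u) s with h | h
        · exact Or.inr (hex u hu h)
        · exact Or.inl h
      rw [this]; simp
    rw [this]
    simp

lemma toll_measE : MeasurableSet {z : (ℝ × ℝ) × (ℝ × ℝ) |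
        (0 < z.2.1 ∧ z.2.1 < z.1.1) ∧ 0 < z.2.2 ∧ z.2.2 < z.1.2} := by
  have a1 : MeasurableSet {z : (ℝ × ℝ) × (ℝ × ℝ) | 0 < z.2.1} :=
    measurableSet_lt (by fun_prop) (by fun_prop)
  have a2 : MeasurableSet {z : (ℝ × ℝ) × (ℝ × ℝ) | z.2.1 < z.1.1} :=
    measurableSet_lt (by fun_prop) (by fun_prop)
  have a3 : MeasurableSet {z : (ℝ × ℝ) × (ℝ × ℝ) | 0 < z.2.2} :=
    measurableSet_lt (by fun_prop) (by fun_prop)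
  have a4 : MeasurableSet {z : (ℝ × ℝ) × (ℝ × ℝ) | z.2.2 < z.1.2} :=
    measurableSet_lt (by fun_prop) (by fun_prop)
  exact (a1.inter a2).inter (a3.inter a4)

lemma toll_layer (P : Measure (ℝ × ℝ)) [IsProbabilityMeasure P] :
    ∫⁻ p, ENNReal.ofReal p.1 * ENNReal.ofReal p.2 ∂P =
      ∫⁻ q : ℝ × ℝ, P {p | (0 < q.1 ∧ q.1 < p.1) ∧ 0 < q.2 ∧ q.2 < p.2} := by
  let E : Set ((ℝ × ℝ) × (ℝ × ℝ)) :=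
    {z | (0 < z.2.1 ∧ z.2.1 < z.1.1) ∧ 0 < z.2.2 ∧ z.2.2 < z.1.2}
  have hE : MeasurableSet E := toll_measE
  have h1 := Measure.prod_apply (μ := P) (ν := (volume : Measure (ℝ × ℝ))) hE
  have h2 := Measure.prod_apply_symm (μ := P) (ν := (volume : Measure (ℝ × ℝ))) hE
  rw [h1] at h2
  refine Eq.trans ?_ h2
  refine lintegral_congr fun p => ?_
  have : (Prod.mk p ⁻¹' E) = Set.Ioo 0 p.1 ×ˢ Set.Ioo 0 p.2 := by
    ext q; simp [E]
  rw [this, Measure.volume_eq_prod, Measure.prod_prod]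
  simp

lemma toll_rearr (P Q : Measure (ℝ × ℝ)) [IsProbabilityMeasure P] [IsProbabilityMeasure Q]
    (h1 : P.map Prod.fst = Q.map Prod.fst) (h2 : P.map Prod.snd = Q.map Prod.snd)
    (hQ : ∀ s s', Q (Set.Ioi s ×ˢ Set.Ioi s') ≤
      Q.map Prod.fst (Set.Ioi s) + Q.map Prod.snd (Set.Ioi s') - 1)
    (hpos1 : Q.map Prod.fst (Set.Ioi 0)ᶜ = 0) (hpos2 : Q.map Prod.snd (Set.Ioi 0)ᶜ = 0) :
    ∫⁻ p, ENNReal.ofReal p.1 * ENNReal.ofReal p.2 ∂Q ≤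
      ∫⁻ p, ENNReal.ofReal p.1 * ENNReal.ofReal p.2 ∂P ∧
    (∫⁻ p, ENNReal.ofReal p.1 * ENNReal.ofReal p.2 ∂P ≤
      ∫⁻ p, ENNReal.ofReal p.1 * ENNReal.ofReal p.2 ∂Q →
      ∫⁻ p, ENNReal.ofReal p.1 * ENNReal.ofReal p.2 ∂Q ≠ ∞ → P = Q) := by
  have hD : ∀ s s', Q (Set.Ioi s ×ˢ Set.Ioi s') ≤ P (Set.Ioi s ×ˢ Set.Ioi s') := by
    intro s s'
    refine (hQ s s').trans ?_
    rw [← h1, ← h2, Measure.map_apply measurable_fst measurableSet_Ioi,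
      Measure.map_apply measurable_snd measurableSet_Ioi,
      ← measure_union_add_inter _ (measurable_snd measurableSet_Ioi), tsub_le_iff_left]
    refine add_le_add prob_le_one le_rfl
  let f : Measure (ℝ × ℝ) → ℝ × ℝ → ℝ≥0∞ := fun P q =>
    P {p | (0 < q.1 ∧ q.1 < p.1) ∧ 0 < q.2 ∧ q.2 < p.2}
  have hf : ∀ P : Measure (ℝ × ℝ), ∀ a b, 0 < a → 0 < b →
      f P (a, b) = P (Set.Ioi a ×ˢ Set.Ioi b) := by
    intro P a b ha hb
    simp only [f, ha, hb, true_and]; rfl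
  have hle : ∀ q, f Q q ≤ f P q := by
    rintro ⟨a, b⟩
    by_cases ha : 0 < a
    · by_cases hb : 0 < b
      · rw [hf _ a b ha hb, hf _ a b ha hb]; exact hD a b
      · simp [f, hb]
    · simp [f, ha]
  rw [toll_layer P, toll_layer Q]
  refine ⟨lintegral_mono hle, fun hge hfin => ?_⟩
  have hmeas : ∀ P : Measure (ℝ × ℝ), IsProbabilityMeasure P → Measurable (f P) := by
    intro P hP
    exact measurable_measure_prodMk_right toll_measE
  have hae : f Q =ᵐ[volume] f P := ae_eq_of_ae_le_of_lintegral_le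
    (Filter.Eventually.of_forall hle) hfin (hmeas P inferInstance).aemeasurable hge
  have hEq0 : ∀ s s', 0 ≤ s → 0 ≤ s' →
      P (Set.Ioi s ×ˢ Set.Ioi s') ≤ Q (Set.Ioi s ×ˢ Set.Ioi s') := by
    intro s s' hs hs'
    have hU : Set.Ioi s ×ˢ Set.Ioi s' =
        ⋃ n : ℕ, Set.Ioi (s + 1 / ((n:ℝ) + 1)) ×ˢ Set.Ioi (s' + 1 / ((n:ℝ) + 1)) := by
      ext ⟨x, y⟩
      simp only [Set.mem_prod, Set.mem_Ioi, Set.mem_iUnion]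
      constructor
      · rintro ⟨hx, hy⟩
        obtain ⟨n, hn⟩ := exists_nat_one_div_lt (lt_min (sub_pos.2 hx) (sub_pos.2 hy))
        rw [lt_min_iff] at hn
        exact ⟨n, by linarith, by linarith⟩
      · rintro ⟨n, hx, hy⟩
        have : (0:ℝ) < 1 / ((n:ℝ) + 1) := by positivity
        exact ⟨by linarith, by linarith⟩
    rw [hU, Monotone.measure_iUnion, ← hU]
    · refine iSup_le fun n => ?_
      set e : ℝ := 1 / ((n:ℝ) + 1) with he
      have hepos : 0 < e := by positivity
      have hbox : volume (Set.Ioo s (s + e) ×ˢ Set.Ioo s' (s' + e)) ≠ 0 := by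
        rw [Measure.volume_eq_prod, Measure.prod_prod]
        simp [hepos]
      obtain ⟨⟨a, b⟩, hab, habe⟩ : ∃ q ∈ Set.Ioo s (s + e) ×ˢ Set.Ioo s' (s' + e),
          f Q q = f P q := by
        by_contra hcon
        push Not at hcon
        exact hbox (measure_mono_null (fun q hq => hcon q hq) hae)
      obtain ⟨⟨ha1, ha2⟩, hb1, hb2⟩ := hab
      simp only at ha1 ha2 hb1 hb2
      rw [hf _ a b (by linarith) (by linarith), hf _ a b (by linarith) (by linarith)] at habe
      calc _ ≤ P (Set.Ioi a ×ˢ Set.Ioi b) :=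
            measure_mono (Set.prod_mono (Set.Ioi_subset_Ioi ha2.le) (Set.Ioi_subset_Ioi hb2.le))
        _ = Q (Set.Ioi a ×ˢ Set.Ioi b) := habe.symm
        _ ≤ _ := measure_mono
            (Set.prod_mono (Set.Ioi_subset_Ioi ha1.le) (Set.Ioi_subset_Ioi hb1.le))
    · intro n m hnm
      have : (1:ℝ) / ((m:ℝ) + 1) ≤ 1 / ((n:ℝ) + 1) := Nat.one_div_le_one_div hnm
      exact Set.prod_mono (Set.Ioi_subset_Ioi (by linarith)) (Set.Ioi_subset_Ioi (by linarith))
  have hP1 : ∀ K : Measure (ℝ × ℝ), K.map Prod.fst (Set.Ioi 0)ᶜ = 0 →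
      K.map Prod.snd (Set.Ioi 0)ᶜ = 0 → ∀ s s',
      K (Set.Ioi s ×ˢ Set.Ioi s') = K (Set.Ioi (max s 0) ×ˢ Set.Ioi (max s' 0)) := by
    intro K hR1 hR2 s s'
    rw [Measure.map_apply measurable_fst measurableSet_Ioi.compl] at hR1
    rw [Measure.map_apply measurable_snd measurableSet_Ioi.compl] at hR2
    have a1 : ∀ᵐ p ∂K, 0 < p.1 := by
      rw [ae_iff]; exact hR1
    have a2 : ∀ᵐ p ∂K, 0 < p.2 := by
      rw [ae_iff]; exact hR2
    refine measure_congr ?_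
    filter_upwards [a1, a2] with p hp1 hp2
    apply propext
    change (s < p.1 ∧ s' < p.2) ↔ (max s 0 < p.1 ∧ max s' 0 < p.2)
    simp [hp1, hp2]
  have hgen : (Prod.instMeasurableSpace : MeasurableSpace (ℝ × ℝ)) =
      MeasurableSpace.generateFrom
        (Set.image2 (· ×ˢ ·) (Set.range (Set.Ioi : ℝ → Set ℝ)) (Set.range Set.Ioi)) := by
    have hsp : IsCountablySpanning (Set.range (Set.Ioi : ℝ → Set ℝ)) := by
      refine ⟨fun n => Set.Ioi (-(n:ℝ)), fun n => ⟨_, rfl⟩, ?_⟩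
      ext x
      simp only [Set.mem_iUnion, Set.mem_Ioi, Set.mem_univ, iff_true]
      obtain ⟨n, hn⟩ := exists_nat_gt (-x)
      exact ⟨n, by linarith⟩
    rw [← generateFrom_prod_eq hsp hsp, ← borel_eq_generateFrom_Ioi]
  refine ext_of_generate_finite _ hgen (isPiSystem_Ioi.prod isPiSystem_Ioi) ?_ (by simp)
  rintro _ ⟨_, ⟨s, rfl⟩, _, ⟨s', rfl⟩, rfl⟩
  simp only
  rw [hP1 P (h1 ▸ hpos1) (h2 ▸ hpos2), hP1 Q hpos1 hpos2]
  exact le_antisymm (hEq0 _ _ (le_max_right _ _) (le_max_right _ _)) (hD _ _)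

def TollK (r t_f : ℝ) : Set (ℝ → ℝ) :=
  {τ | Monotone τ ∧ (∀ u, τ u ∈ Set.Icc 0 t_f) ∧
    ∀ u ∈ Set.Ioo (0:ℝ) 1, ∀ v ∈ Set.Ioo (0:ℝ) 1, u ≤ v → τ u + (v - u) / r ≤ τ v}

noncomputable def TollJ (t_f : ℝ) (X Y τ : ℝ → ℝ) : ℝ≥0∞ :=
  ∫⁻ u in Set.Ioo (0:ℝ) 1, (ENNReal.ofReal (X u ^ 2) * ENNReal.ofReal (τ u)⁻¹ +
    ENNReal.ofReal (Y u ^ 2) * ENNReal.ofReal (t_f - τ u)⁻¹)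

lemma tollK_pos {r t_f : ℝ} (hr : 0 < r) {τ : ℝ → ℝ} (h : τ ∈ TollK r t_f) {u : ℝ}
    (hu : u ∈ Set.Ioo (0:ℝ) 1) : 0 < τ u ∧ τ u < t_f := by
  obtain ⟨h1, h2, h3⟩ := h
  constructor
  · have := h3 (u / 2) ⟨by linarith [hu.1], by linarith [hu.1, hu.2]⟩ u hu (by linarith [hu.1])
    have h4 : 0 < (u - u / 2) / r := div_pos (by linarith [hu.1]) hr
    linarith [(h2 (u / 2)).1]
  · have := h3 u hu ((u + 1) / 2) ⟨by linarith [hu.1], by linarith [hu.1, hu.2]⟩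
      (by linarith [hu.2])
    have h4 : 0 < ((u + 1) / 2 - u) / r := div_pos (by linarith [hu.2]) hr
    linarith [(h2 ((u + 1) / 2)).2]

lemma toll_inv_mid {a b T : ℝ} (ha : 0 < a) (hb : 0 < b) (haT : a < T) (hbT : b < T) :
    2 * ((a + b) / 2)⁻¹ + (a - b) ^ 2 / (2 * T ^ 3) ≤ a⁻¹ + b⁻¹ := by
  have hT : 0 < T := ha.trans haT
  have e : a⁻¹ + b⁻¹ - 2 * ((a + b) / 2)⁻¹ = (a - b) ^ 2 / (a * b * (a + b)) := by
    field_simp; ring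
  have : (a - b) ^ 2 / (2 * T ^ 3) ≤ (a - b) ^ 2 / (a * b * (a + b)) := by
    refine div_le_div_of_nonneg_left (sq_nonneg _) (by positivity) ?_
    calc a * b * (a + b) ≤ T * T * (T + T) := by gcongr
      _ = 2 * T ^ 3 := by ring
  linarith

lemma toll_inv_mid' {a b : ℝ} (ha : 0 < a) (hb : 0 < b) :
    2 * ((a + b) / 2)⁻¹ ≤ a⁻¹ + b⁻¹ := by
  have e : a⁻¹ + b⁻¹ - 2 * ((a + b) / 2)⁻¹ = (a - b) ^ 2 / (a * b * (a + b)) := by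
    field_simp; ring
  have : 0 ≤ (a - b) ^ 2 / (a * b * (a + b)) := by positivity
  linarith

lemma toll_meas_integrand {t_f : ℝ} {X Y τ : ℝ → ℝ} (hX : Measurable X) (hY : Measurable Y)
    (hτ : Measurable τ) : Measurable (fun u => ENNReal.ofReal (X u ^ 2) * ENNReal.ofReal (τ u)⁻¹ +
    ENNReal.ofReal (Y u ^ 2) * ENNReal.ofReal (t_f - τ u)⁻¹) := by
  fun_prop

lemma toll_mid {r t_f : ℝ} (hr : 0 < r) {X Y : ℝ → ℝ} (hX : Measurable X)
    (hY : Measurable Y) {τ₁ τ₂ : ℝ → ℝ} (h₁ : τ₁ ∈ TollK r t_f) (h₂ : τ₂ ∈ TollK r t_f) :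
    (fun u => (τ₁ u + τ₂ u) / 2) ∈ TollK r t_f ∧
    2 * TollJ t_f X Y (fun u => (τ₁ u + τ₂ u) / 2) +
      ∫⁻ u in Set.Ioo (0:ℝ) 1, ENNReal.ofReal (X u ^ 2 / (2 * t_f ^ 3) * (τ₁ u - τ₂ u) ^ 2) ≤
      TollJ t_f X Y τ₁ + TollJ t_f X Y τ₂ := by
  have m1 : Measurable τ₁ := h₁.1.measurable
  have m2 : Measurable τ₂ := h₂.1.measurable
  constructor
  · refine ⟨fun u v huv => ?_, fun u => ⟨?_, ?_⟩, fun u hu v hv huv => ?_⟩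
    · have := h₁.1 huv; have := h₂.1 huv; simp only; linarith
    · have := (h₁.2.1 u).1; have := (h₂.2.1 u).1; linarith
    · have := (h₁.2.1 u).2; have := (h₂.2.1 u).2; linarith
    · have := h₁.2.2 u hu v hv huv; have := h₂.2.2 u hu v hv huv; simp only; linarith
  · unfold TollJ
    rw [← lintegral_const_mul _ (by fun_prop), ← lintegral_add_left (by fun_prop),
      ← lintegral_add_left (by fun_prop)]
    refine setLIntegral_mono (by fun_prop) fun u hu => ?_
    obtain ⟨a1, a2⟩ := tollK_pos hr h₁ hu
    obtain ⟨b1, b2⟩ := tollK_pos hr h₂ hu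
    have hT : 0 < t_f := a1.trans a2
    have hm1 : 0 < (τ₁ u + τ₂ u) / 2 := by linarith
    have hm2 : 0 < t_f - (τ₁ u + τ₂ u) / 2 := by linarith
    have c1 : 0 < t_f - τ₁ u := by linarith
    have c2 : 0 < t_f - τ₂ u := by linarith
    have e2 : (2 : ℝ≥0∞) = ENNReal.ofReal 2 := by simp
    rw [e2]
    simp only [← ENNReal.ofReal_mul (sq_nonneg _)]
    rw [← ENNReal.ofReal_add (by positivity) (by positivity),
      ← ENNReal.ofReal_add (by positivity) (by positivity),
      ← ENNReal.ofReal_add (by positivity) (by positivity),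
      ← ENNReal.ofReal_mul (by norm_num),
      ← ENNReal.ofReal_add (by positivity) (by positivity),
      ← ENNReal.ofReal_add (by positivity) (by positivity)]
    refine ENNReal.ofReal_le_ofReal ?_
    have k1 := mul_le_mul_of_nonneg_left (toll_inv_mid a1 b1 a2 b2) (sq_nonneg (X u))
    have k2 := mul_le_mul_of_nonneg_left (toll_inv_mid' c1 c2) (sq_nonneg (Y u))
    have e3 : (t_f - τ₁ u + (t_f - τ₂ u)) / 2 = t_f - (τ₁ u + τ₂ u) / 2 := by ring
    rw [e3] at k2
    have e4 : X u ^ 2 / (2 * t_f ^ 3) * (τ₁ u - τ₂ u) ^ 2 =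
      X u ^ 2 * ((τ₁ u - τ₂ u) ^ 2 / (2 * t_f ^ 3)) := by ring
    rw [e4]
    linarith

lemma toll_unique {r t_f : ℝ} (hr : 0 < r) (ht : 0 < t_f) {X Y : ℝ → ℝ} (hX : Measurable X)
    (hY : Measurable Y) (hXpos : ∀ᵐ u ∂(volume.restrict (Set.Ioo (0:ℝ) 1)), X u ≠ 0)
    {τ₁ τ₂ : ℝ → ℝ} (h₁ : τ₁ ∈ TollK r t_f) (h₂ : τ₂ ∈ TollK r t_f)
    (hmin : ∀ τ ∈ TollK r t_f, TollJ t_f X Y τ₁ ≤ TollJ t_f X Y τ)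
    (h12 : TollJ t_f X Y τ₂ ≤ TollJ t_f X Y τ₁)
    (hfin : TollJ t_f X Y τ₁ ≠ ∞) :
    τ₁ =ᵐ[volume.restrict (Set.Ioo (0:ℝ) 1)] τ₂ := by
  have m1 : Measurable τ₁ := h₁.1.measurable
  have m2 : Measurable τ₂ := h₂.1.measurable
  obtain ⟨hm, hle⟩ := toll_mid hr hX hY h₁ h₂
  have h3 := hmin _ hm
  have h4 : 2 * TollJ t_f X Y τ₁ + ∫⁻ u in Set.Ioo (0:ℝ) 1,
      ENNReal.ofReal (X u ^ 2 / (2 * t_f ^ 3) * (τ₁ u - τ₂ u) ^ 2) ≤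
      2 * TollJ t_f X Y τ₁ + 0 := by
    calc _ ≤ _ := add_le_add (mul_le_mul_right h3 2) le_rfl
      _ ≤ _ := hle
      _ ≤ TollJ t_f X Y τ₁ + TollJ t_f X Y τ₁ := add_le_add le_rfl h12
      _ = _ := by rw [two_mul, add_zero]
  have h5 := (ENNReal.add_le_add_iff_left (ENNReal.mul_ne_top (by simp) hfin)).1 h4
  have h6 := (lintegral_eq_zero_iff (by fun_prop)).1 (le_antisymm h5 zero_le)
  filter_upwards [h6, hXpos] with u hu hXu
  simp only [Pi.zero_apply, ENNReal.ofReal_eq_zero] at hu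
  by_contra hne
  have : 0 < (τ₁ u - τ₂ u) ^ 2 := by
    have := sub_ne_zero.2 hne
    positivity
  have : 0 < X u ^ 2 / (2 * t_f ^ 3) * (τ₁ u - τ₂ u) ^ 2 := by positivity
  linarith

lemma toll_finite {r t_f M : ℝ} (hr : 0 < r) (hrt : 1 < r * t_f) {X Y : ℝ → ℝ}
    (hXM : ∀ u, X u ^ 2 ≤ M ^ 2) (hYM : ∀ u, Y u ^ 2 ≤ M ^ 2) :
    ∃ τ ∈ TollK r t_f, TollJ t_f X Y τ ≠ ∞ := by
  set e : ℝ := (t_f - 1 / r) / 2 with he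
  have h1r : 1 / r < t_f := by rw [div_lt_iff₀ hr]; linarith
  have hepos : 0 < e := by rw [he]; linarith
  have hr' : 0 < 1 / r := by positivity
  let c : ℝ → ℝ := fun u => max 0 (min u 1)
  have c0 : ∀ u, 0 ≤ c u := fun u => le_max_left _ _
  have c1 : ∀ u, c u ≤ 1 := fun u => max_le (by norm_num) (min_le_right _ _)
  have cm : Monotone c := fun u v h => max_le_max le_rfl (min_le_min h le_rfl)
  have cI : ∀ u ∈ Set.Ioo (0:ℝ) 1, c u = u := fun u hu => by
    simp [c, min_eq_left hu.2.le, max_eq_right hu.1.le]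
  have b0 : ∀ u, e ≤ e + c u * (1 / r) := fun u => by
    have := mul_nonneg (c0 u) hr'.le; linarith
  have b1 : ∀ u, e + c u * (1 / r) ≤ t_f - e := fun u => by
    have := mul_le_mul_of_nonneg_right (c1 u) hr'.le; linarith
  refine ⟨fun u => e + c u * (1 / r), ⟨?_, ?_, ?_⟩, ?_⟩
  · intro u v h
    have := mul_le_mul_of_nonneg_right (cm h) hr'.le
    simp only; linarith
  · intro u
    exact ⟨by linarith [b0 u], by linarith [b1 u]⟩
  · intro u hu v hv _
    simp only [cI u hu, cI v hv]
    apply le_of_eq; ring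
  · refine ne_of_lt (lt_of_le_of_lt (setLIntegral_mono (g := fun _ =>
      ENNReal.ofReal (M ^ 2) * ENNReal.ofReal e⁻¹ + ENNReal.ofReal (M ^ 2) * ENNReal.ofReal e⁻¹)
      (by fun_prop) fun u hu => ?_) ?_)
    · have k1 : e ≤ t_f - (e + c u * (1 / r)) := by linarith [b1 u]
      refine add_le_add (mul_le_mul' (ENNReal.ofReal_le_ofReal (hXM u)) (ENNReal.ofReal_le_ofReal ?_))
        (mul_le_mul' (ENNReal.ofReal_le_ofReal (hYM u)) (ENNReal.ofReal_le_ofReal ?_))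
      · exact inv_anti₀ hepos (b0 u)
      · exact inv_anti₀ hepos k1
    · rw [setLIntegral_const]
      simp [ENNReal.mul_lt_top_iff]

lemma toll_limsup {r t_f : ℝ} (s : ℕ → ℝ → ℝ) (hs : ∀ n, s n ∈ TollK r t_f) :
    (fun u => Filter.limsup (fun n => s n u) Filter.atTop) ∈ TollK r t_f := by
  have ba : ∀ u, Filter.IsBoundedUnder (· ≤ ·) Filter.atTop (fun n => s n u) := fun u =>
    Filter.isBoundedUnder_of ⟨t_f, fun n => ((hs n).2.1 u).2⟩
  have bb : ∀ u, Filter.IsBoundedUnder (· ≥ ·) Filter.atTop (fun n => s n u) := fun u =>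
    Filter.isBoundedUnder_of ⟨0, fun n => ((hs n).2.1 u).1⟩
  refine ⟨fun u v huv => ?_, fun u => ⟨?_, ?_⟩, fun u hu v hv huv => ?_⟩
  · exact Filter.limsup_le_limsup (Filter.Eventually.of_forall fun n => (hs n).1 huv)
      (bb u).isCobounded_le (ba v)
  · exact Filter.le_limsup_of_frequently_le
      (Filter.Frequently.of_forall fun n => ((hs n).2.1 u).1) (ba u)
  · exact Filter.limsup_le_of_le (bb u).isCobounded_le
      (Filter.Eventually.of_forall fun n => ((hs n).2.1 u).2)
  · simp only
    rw [← limsup_add_const _ _ _ (ba u) (bb u).isCobounded_le]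
    refine Filter.limsup_le_limsup
      (Filter.Eventually.of_forall fun n => (hs n).2.2 u hu v hv huv) ?_ (ba v)
    exact (Filter.isBoundedUnder_of (r := (· ≥ ·)) ⟨0 + (v - u) / r, fun n => 
      add_le_add ((hs n).2.1 u).1 le_rfl⟩).isCobounded_le

lemma toll_exists {r t_f M : ℝ} (hr : 0 < r) (ht : 0 < t_f) (hrt : 1 < r * t_f) {X Y : ℝ → ℝ}
    (hX : Measurable X)
    (hY : Measurable Y) (hXpos : ∀ᵐ u ∂(volume.restrict (Set.Ioo (0:ℝ) 1)), X u ≠ 0)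
    (hXM : ∀ u, X u ^ 2 ≤ M ^ 2) (hYM : ∀ u, Y u ^ 2 ≤ M ^ 2) :
    ∃ τ ∈ TollK r t_f, (∀ τ' ∈ TollK r t_f, TollJ t_f X Y τ ≤ TollJ t_f X Y τ') ∧
      TollJ t_f X Y τ ≠ ∞ := by
  obtain ⟨τ₀, hτ₀, hfin⟩ := toll_finite (M := M) hr hrt hXM hYM
  set I : ℝ≥0∞ := sInf (TollJ t_f X Y '' TollK r t_f) with hI
  have hIle : ∀ τ ∈ TollK r t_f, I ≤ TollJ t_f X Y τ := fun τ hτ => sInf_le ⟨τ, hτ, rfl⟩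
  have hIfin : I ≠ ∞ := ne_top_of_le_ne_top hfin (hIle _ hτ₀)
  have hseq : ∀ n : ℕ, ∃ τ ∈ TollK r t_f,
      TollJ t_f X Y τ < I + ENNReal.ofReal ((1 / 16) ^ n) := by
    intro n
    have : I < I + ENNReal.ofReal ((1 / 16) ^ n) :=
      ENNReal.lt_add_right hIfin (by
        rw [Ne, ENNReal.ofReal_eq_zero, not_le]; positivity)
    obtain ⟨_, ⟨τ, hτ, rfl⟩, h⟩ := sInf_lt_iff.1 this
    exact ⟨τ, hτ, h⟩
  choose s hs hsJ using hseq
  have hsm : ∀ n, Measurable (s n) := fun n => (hs n).1.measurable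
  have hD : ∀ n, ∫⁻ u in Set.Ioo (0:ℝ) 1,
      ENNReal.ofReal (X u ^ 2 / (2 * t_f ^ 3) * (s n u - s (n + 1) u) ^ 2) ≤
      ENNReal.ofReal (2 * (1 / 16) ^ n) := by
    intro n
    obtain ⟨hm, hle⟩ := toll_mid hr hX hY (hs n) (hs (n + 1))
    refine (ENNReal.add_le_add_iff_left (ENNReal.mul_ne_top (by simp : (2:ℝ≥0∞) ≠ ∞) hIfin)).1 ?_
    calc _ ≤ _ := add_le_add (mul_le_mul_right (hIle _ hm) 2) le_rfl
      _ ≤ _ := hle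
      _ ≤ (I + ENNReal.ofReal ((1 / 16) ^ n)) + (I + ENNReal.ofReal ((1 / 16) ^ n)) := by
          refine add_le_add (hsJ n).le ((hsJ (n + 1)).le.trans ?_)
          refine add_le_add le_rfl (ENNReal.ofReal_le_ofReal ?_)
          exact pow_le_pow_of_le_one (by norm_num) (by norm_num) (Nat.le_succ n)
      _ = _ := by
          rw [ENNReal.ofReal_mul (by norm_num)]
          simp only [ENNReal.ofReal_ofNat]
          ring
  have hsum : ∫⁻ u in Set.Ioo (0:ℝ) 1, ∑' n : ℕ,
      ENNReal.ofReal (4 ^ n * (X u ^ 2 / (2 * t_f ^ 3) * (s n u - s (n + 1) u) ^ 2)) ≠ ∞ := by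
    rw [lintegral_tsum fun n => by fun_prop]
    have hS : Summable (fun n : ℕ => 2 * (1 / 4 : ℝ) ^ n) :=
      (summable_geometric_of_lt_one (by norm_num) (by norm_num)).mul_left 2
    refine ne_top_of_le_ne_top hS.tsum_ofReal_ne_top (ENNReal.tsum_le_tsum fun n => ?_)
    simp_rw [ENNReal.ofReal_mul (show (0:ℝ) ≤ 4 ^ n by positivity)]
    rw [lintegral_const_mul _ (by fun_prop)]
    refine (mul_le_mul_right (hD n) _).trans (le_of_eq ?_)
    rw [← ENNReal.ofReal_mul (by positivity)]
    congr 1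
    rw [show (1 / 4 : ℝ) = 4 * (1 / 16) by norm_num, mul_pow]; ring
  have hconv : ∀ᵐ u ∂(volume.restrict (Set.Ioo (0:ℝ) 1)),
      Filter.Tendsto (fun n => s n u) Filter.atTop
        (nhds (Filter.limsup (fun n => s n u) Filter.atTop)) := by
    filter_upwards [ae_lt_top (by fun_prop) hsum, hXpos] with u hu hXu
    set S := ∑' n : ℕ,
      ENNReal.ofReal (4 ^ n * (X u ^ 2 / (2 * t_f ^ 3) * (s n u - s (n + 1) u) ^ 2)) with hSdef
    have hw : 0 < X u ^ 2 / (2 * t_f ^ 3) := by positivity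
    have hterm : ∀ n, dist (s n u) (s (n + 1) u) ≤
        Real.sqrt (S.toReal / (X u ^ 2 / (2 * t_f ^ 3))) * (1 / 2) ^ n := by
      intro n
      have h1 : ENNReal.ofReal (4 ^ n * (X u ^ 2 / (2 * t_f ^ 3) *
        (s n u - s (n + 1) u) ^ 2)) ≤ S := ENNReal.le_tsum n
      have h2 := (ENNReal.ofReal_le_iff_le_toReal hu.ne).1 h1
      have h3 : (2 ^ n * (s n u - s (n + 1) u)) ^ 2 ≤
          S.toReal / (X u ^ 2 / (2 * t_f ^ 3)) := by
        rw [le_div_iff₀ hw, mul_pow, ← pow_mul, mul_comm n 2, pow_mul]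
        norm_num
        linarith
      have h4 := Real.abs_le_sqrt h3
      rw [abs_mul, abs_of_pos (by positivity : (0:ℝ) < 2 ^ n)] at h4
      rw [Real.dist_eq, one_div, inv_pow, ← div_eq_mul_inv, le_div_iff₀ (by positivity)]
      linarith
    have hc := cauchySeq_of_le_geometric (1 / 2) _ (by norm_num) hterm
    obtain ⟨l, hl⟩ := cauchySeq_tendsto_of_complete hc
    rw [hl.limsup_eq]; exact hl
  refine ⟨_, toll_limsup s hs, ?_⟩
  set τ : ℝ → ℝ := fun u => Filter.limsup (fun n => s n u) Filter.atTop with hτ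
  have hτK : τ ∈ TollK r t_f := toll_limsup s hs
  have hJI : TollJ t_f X Y τ ≤ I := by
    have hF := lintegral_liminf_le (μ := volume.restrict (Set.Ioo (0:ℝ) 1)) (u := Filter.atTop)
      (f := fun n u => ENNReal.ofReal (X u ^ 2) * ENNReal.ofReal (s n u)⁻¹ +
        ENNReal.ofReal (Y u ^ 2) * ENNReal.ofReal (t_f - s n u)⁻¹)
      (fun n => toll_meas_integrand hX hY (hsm n))
    calc TollJ t_f X Y τ = _ := by
          refine lintegral_congr_ae ?_
          filter_upwards [hconv, ae_restrict_mem measurableSet_Ioo] with u hu huI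
          obtain ⟨p1, p2⟩ := tollK_pos hr hτK huI
          refine (Filter.Tendsto.liminf_eq ?_).symm
          refine Filter.Tendsto.add ?_ ?_
          · refine ENNReal.Tendsto.const_mul (ENNReal.tendsto_ofReal (hu.inv₀ p1.ne'))
              (Or.inr ENNReal.ofReal_ne_top)
          · refine ENNReal.Tendsto.const_mul (ENNReal.tendsto_ofReal
              ((tendsto_const_nhds.sub hu).inv₀ (by simp only [hτ] at p2; linarith)))
              (Or.inr ENNReal.ofReal_ne_top)
      _ ≤ _ := hF
      _ ≤ Filter.liminf (fun n : ℕ => I + ENNReal.ofReal ((1 / 16) ^ n)) Filter.atTop :=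
          Filter.liminf_le_liminf (Filter.Eventually.of_forall fun n => (hsJ n).le)
      _ = I := by
          refine Filter.Tendsto.liminf_eq ?_
          have h0 : Filter.Tendsto (fun n : ℕ => ENNReal.ofReal ((1 / 16 : ℝ) ^ n)) Filter.atTop
              (nhds 0) := by
            rw [← ENNReal.ofReal_zero]
            exact ENNReal.tendsto_ofReal
              (tendsto_pow_atTop_nhds_zero_of_lt_one (by norm_num) (by norm_num))
          simpa using tendsto_const_nhds.add h0
  exact ⟨fun τ' hτ' => hJI.trans (hIle τ' hτ'), ne_top_of_le_ne_top hIfin hJI⟩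

lemma toll_quantile' (ρ : Measure ℝ) [IsProbabilityMeasure ρ] (a b : ℝ) (hab : a ≤ b)
    (h : ρ (Set.Icc a b)ᶜ = 0) :
    ∃ q : ℝ → ℝ, Antitone q ∧ (∀ u, q u ∈ Set.Icc a b) ∧
      (volume.restrict (Set.Ioo (0:ℝ) 1)).map q = ρ := by
  obtain ⟨q, h1, h2, h3⟩ := toll_quantile ρ a b hab h
  refine ⟨fun u => q (1 - u), fun u v huv => h1 (by linarith), fun u => h2 _, ?_⟩
  have hp : (volume.restrict (Set.Ioo (0:ℝ) 1)).map (fun u => 1 - u) =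
      volume.restrict (Set.Ioo (0:ℝ) 1) := by
    have := ((Measure.measurePreserving_sub_left volume (1:ℝ)).restrict_preimage
      (measurableSet_Ioo (a := (0:ℝ)) (b := 1))).map_eq
    simpa using this
  have : (fun u => q (1 - u)) = q ∘ (fun u => 1 - u) := rfl
  rw [this, ← Measure.map_map h1.measurable (by fun_prop), hp, h3]

lemma toll_law_le {r t_f : ℝ} (hr : 0 < r) {τ : ℝ → ℝ} (h : τ ∈ TollK r t_f) :
    (volume.restrict (Set.Ioo (0:ℝ) 1)).map τ ≤
      ENNReal.ofReal r • volume.restrict (Set.Icc 0 t_f) := by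
  have hm : Measurable τ := h.1.measurable
  refine Measure.le_iff.2 fun E hE => ?_
  rw [Measure.map_apply hm hE, Measure.restrict_apply (hm hE), Measure.smul_apply,
    Measure.restrict_apply hE, smul_eq_mul]
  set W := τ ⁻¹' E ∩ Set.Ioo 0 1 with hW
  have hinj : Set.InjOn τ (Set.Ioo 0 1) := by
    have hlt : ∀ u ∈ Set.Ioo (0:ℝ) 1, ∀ v ∈ Set.Ioo (0:ℝ) 1, u < v → τ u < τ v := by
      intro u hu v hv huv
      have := h.2.2 u hu v hv huv.le
      have h2 : 0 < (v - u) / r := div_pos (by linarith) hr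
      linarith
    exact StrictMonoOn.injOn (fun u hu v hv huv => hlt u hu v hv huv)
  set g := Function.invFunOn τ (Set.Ioo (0:ℝ) 1) with hg
  have hgτ : ∀ u ∈ Set.Ioo (0:ℝ) 1, g (τ u) = u := fun u hu => hinj.leftInvOn_invFunOn hu
  have hkey : ∀ u ∈ Set.Ioo (0:ℝ) 1, ∀ v ∈ Set.Ioo (0:ℝ) 1, u ≤ v →
      |u - v| ≤ r * |τ u - τ v| := by
    intro u hu v hv huv
    have h1 := h.2.2 u hu v hv huv
    have h2 : (v - u) / r ≤ τ v - τ u := by linarith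
    rw [div_le_iff₀ hr] at h2
    have h3 := h.1 huv
    rw [abs_sub_comm, abs_of_nonneg (by linarith), abs_sub_comm, abs_of_nonneg (by linarith)]
    linarith
  have hlip : LipschitzOnWith r.toNNReal g (τ '' W) := by
    refine LipschitzOnWith.of_dist_le_mul ?_
    rintro _ ⟨u, hu, rfl⟩ _ ⟨v, hv, rfl⟩
    rw [hgτ u hu.2, hgτ v hv.2, Real.coe_toNNReal r hr.le, Real.dist_eq, Real.dist_eq]
    rcases le_total u v with h1 | h1
    · exact hkey u hu.2 v hv.2 h1
    · rw [abs_sub_comm, abs_sub_comm (τ u)]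
      exact hkey v hv.2 u hu.2 h1
  have himg : g '' (τ '' W) = W := by
    rw [Set.image_image]
    ext x
    constructor
    · rintro ⟨u, hu, rfl⟩
      simp only [hgτ u hu.2]; exact hu
    · intro hx; exact ⟨x, hx, hgτ x hx.2⟩
  have h1 := hlip.hausdorffMeasure_image_le (d := 1) zero_le_one
  rw [himg, hausdorffMeasure_real] at h1
  simp only [ENNReal.rpow_one] at h1
  refine h1.trans ?_
  refine mul_le_mul' le_rfl (measure_mono ?_)
  rintro _ ⟨u, hu, rfl⟩
  exact ⟨hu.1, h.2.1 u⟩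

lemma toll_law_ge {r t_f : ℝ} (hr : 0 < r) (ht : 0 < t_f) (ρ : Measure ℝ) [IsProbabilityMeasure ρ]
    (h : ρ ≤ ENNReal.ofReal r • volume.restrict (Set.Icc 0 t_f)) :
    ∃ τ ∈ TollK r t_f, (volume.restrict (Set.Ioo (0:ℝ) 1)).map τ = ρ := by
  have h0 : ρ (Set.Icc 0 t_f)ᶜ = 0 := by
    refine le_antisymm ((h _).trans ?_) zero_le
    rw [Measure.smul_apply, Measure.restrict_apply measurableSet_Icc.compl]
    simp
  obtain ⟨q, h1, h2, h3⟩ := toll_quantile ρ 0 t_f ht.le h0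
  refine ⟨q, ⟨h1, h2, fun u hu v hv huv => ?_⟩, h3⟩
  have k1 : ENNReal.ofReal (v - u) ≤ ρ (Set.Icc (q u) (q v)) := by
    rw [← h3, Measure.map_apply h1.measurable measurableSet_Icc,
      Measure.restrict_apply (h1.measurable measurableSet_Icc), ← Real.volume_Icc]
    exact measure_mono fun w hw => ⟨⟨h1 hw.1, h1 hw.2⟩, hu.1.trans_le hw.1, hw.2.trans_lt hv.2⟩
  have k2 : ρ (Set.Icc (q u) (q v)) ≤ ENNReal.ofReal (r * (q v - q u)) := by
    refine (h _).trans ?_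
    rw [Measure.smul_apply, smul_eq_mul, ENNReal.ofReal_mul hr.le, ← Real.volume_Icc]
    exact mul_le_mul' le_rfl (Measure.restrict_apply_le _ _)
  have k3 := (ENNReal.ofReal_le_ofReal_iff
    (mul_nonneg hr.le (sub_nonneg.2 (h1 huv)))).1 (k1.trans k2)
  have : (v - u) / r ≤ q v - q u := by rw [div_le_iff₀ hr]; linarith
  linarith

lemma toll_cmp {Ω : Type*} [MeasurableSpace Ω] (P : Measure Ω) [IsProbabilityMeasure P]
    (a b : Ω → ℝ) (ha : Measurable a) (hb : Measurable b) (A B : ℝ → ℝ)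
    (hAm : Measurable A) (hBm : Measurable B)
    (hA : MonotoneOn A (Set.Ioo 0 1)) (hB : AntitoneOn B (Set.Ioo 0 1))
    (hApos : ∀ᵐ u ∂(volume.restrict (Set.Ioo (0:ℝ) 1)), 0 < A u)
    (hBpos : ∀ᵐ u ∂(volume.restrict (Set.Ioo (0:ℝ) 1)), 0 < B u)
    (h1 : P.map a = (volume.restrict (Set.Ioo (0:ℝ) 1)).map A)
    (h2 : P.map b = (volume.restrict (Set.Ioo (0:ℝ) 1)).map B) :
    ∫⁻ u in Set.Ioo (0:ℝ) 1, ENNReal.ofReal (A u) * ENNReal.ofReal (B u) ≤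
      ∫⁻ ω, ENNReal.ofReal (a ω) * ENNReal.ofReal (b ω) ∂P ∧
    (∫⁻ ω, ENNReal.ofReal (a ω) * ENNReal.ofReal (b ω) ∂P ≤
      ∫⁻ u in Set.Ioo (0:ℝ) 1, ENNReal.ofReal (A u) * ENNReal.ofReal (B u) →
      ∫⁻ u in Set.Ioo (0:ℝ) 1, ENNReal.ofReal (A u) * ENNReal.ofReal (B u) ≠ ∞ →
      P.map (fun ω => (a ω, b ω)) =
        (volume.restrict (Set.Ioo (0:ℝ) 1)).map (fun u => (A u, B u))) := by
  have : IsProbabilityMeasure (volume.restrict (Set.Ioo (0:ℝ) 1)) := ⟨by simp⟩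
  have mab : Measurable (fun ω => (a ω, b ω)) := ha.prodMk hb
  have mAB : Measurable (fun u => (A u, B u)) := hAm.prodMk hBm
  have i1 := Measure.isProbabilityMeasure_map (μ := P) mab.aemeasurable
  have i2 := Measure.isProbabilityMeasure_map
    (μ := volume.restrict (Set.Ioo (0:ℝ) 1)) mAB.aemeasurable
  have f1 : (P.map (fun ω => (a ω, b ω))).map Prod.fst = P.map a :=
    Measure.map_map measurable_fst mab
  have f2 : (P.map (fun ω => (a ω, b ω))).map Prod.snd = P.map b :=
    Measure.map_map measurable_snd mab
  have g1 : ((volume.restrict (Set.Ioo (0:ℝ) 1)).map (fun u => (A u, B u))).map Prod.fst =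
      (volume.restrict (Set.Ioo (0:ℝ) 1)).map A := Measure.map_map measurable_fst mAB
  have g2 : ((volume.restrict (Set.Ioo (0:ℝ) 1)).map (fun u => (A u, B u))).map Prod.snd =
      (volume.restrict (Set.Ioo (0:ℝ) 1)).map B := Measure.map_map measurable_snd mAB
  have key := toll_rearr (P.map (fun ω => (a ω, b ω)))
    ((volume.restrict (Set.Ioo (0:ℝ) 1)).map (fun u => (A u, B u)))
    (by rw [f1, g1, h1]) (by rw [f2, g2, h2]) (by
      intro s s'
      rw [g1, g2, Measure.map_apply hAm measurableSet_Ioi,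
        Measure.map_apply hBm measurableSet_Ioi,
        Measure.map_apply mAB (measurableSet_Ioi.prod measurableSet_Ioi)]
      exact toll_comono A B hAm hBm hA hB s s') (by
      rw [g1, Measure.map_apply hAm measurableSet_Ioi.compl]
      exact hApos) (by
      rw [g2, Measure.map_apply hBm measurableSet_Ioi.compl]
      exact hBpos)
  rw [lintegral_map (by fun_prop) mab, lintegral_map (by fun_prop) mAB] at key
  exact key

lemma toll_T {r t_f a b : ℝ} (hr : 0 < r) {τ : ℝ → ℝ} (h : τ ∈ TollK r t_f) {X : ℝ → ℝ}
    (hX : Antitone X) (hXb : ∀ u, X u ∈ Set.Icc a b) :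
    ∃ T : ℝ → ℝ, Antitone T ∧ ∀ u ∈ Set.Ioo (0:ℝ) 1, T (τ u) = X u := by
  have hs : StrictMonoOn τ (Set.Ioo 0 1) := by
    intro u hu v hv huv
    have := h.2.2 u hu v hv huv.le
    have h2 : 0 < (v - u) / r := div_pos (by linarith) hr
    linarith
  have hg : ∀ u ∈ Set.Ioo (0:ℝ) 1, Function.invFunOn τ (Set.Ioo (0:ℝ) 1) (τ u) = u :=
    fun u hu => hs.injOn.leftInvOn_invFunOn hu
  have hanti : AntitoneOn (fun t => X (Function.invFunOn τ (Set.Ioo (0:ℝ) 1) t))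
      (τ '' Set.Ioo 0 1) := by
    rintro _ ⟨u, hu, rfl⟩ _ ⟨v, hv, rfl⟩ huv
    simp only [hg u hu, hg v hv]
    exact hX ((hs.le_iff_le hu hv).1 huv)
  obtain ⟨T, hT, hTe⟩ := hanti.exists_antitone_extension
    ⟨a, by rintro _ ⟨t, _, rfl⟩; exact (hXb _).1⟩ ⟨b, by rintro _ ⟨t, _, rfl⟩; exact (hXb _).2⟩
  refine ⟨T, hT, fun u hu => ?_⟩
  rw [← hTe ⟨u, hu, rfl⟩]
  simp only [hg u hu]

lemma toll_density {r t_f : ℝ} (hr : 0 < r) (ρ : Measure ℝ) [IsProbabilityMeasure ρ]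
    (h : ρ ≤ ENNReal.ofReal r • volume.restrict (Set.Icc 0 t_f)) :
    ∃ σ : ℝ → ℝ, (∀ t, 0 ≤ σ t ∧ σ t ≤ r) ∧
      ρ = (volume.restrict (Set.Icc 0 t_f)).withDensity (fun t => ENNReal.ofReal (σ t)) := by
  set m := volume.restrict (Set.Icc (0:ℝ) t_f) with hm
  have hac : ρ ≪ m := (Measure.absolutelyContinuous_of_le h).trans
    (Measure.smul_absolutelyContinuous)
  have hle : ρ.rnDeriv m ≤ᵐ[m] fun _ => ENNReal.ofReal r := by
    refine ae_le_of_forall_setLIntegral_le_of_sigmaFinite (Measure.measurable_rnDeriv ρ m)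
      fun s hs _ => ?_
    refine (Measure.setLIntegral_rnDeriv_le s).trans ((h s).trans ?_)
    simp
  refine ⟨fun t => (min (ρ.rnDeriv m t) (ENNReal.ofReal r)).toReal, fun t => ⟨toReal_nonneg, ?_⟩, ?_⟩
  · exact ENNReal.toReal_le_of_le_ofReal hr.le (min_le_right _ _)
  · conv_lhs => rw [← Measure.withDensity_rnDeriv_eq ρ m hac]
    refine withDensity_congr_ae ?_
    filter_upwards [hle] with t ht
    rw [min_eq_left ht, ENNReal.ofReal_toReal (ne_top_of_le_ne_top ENNReal.ofReal_ne_top ht)]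

lemma toll_t_ae {r t_f : ℝ} (π : Measure (ℝ × ℝ × ℝ))
    (h : π.map (fun p => p.2.2) ≤ ENNReal.ofReal r • volume.restrict (Set.Icc 0 t_f)) :
    ∀ᵐ p ∂π, 0 < p.2.2 ∧ p.2.2 < t_f := by
  have hm : Measurable (fun p : ℝ × ℝ × ℝ => p.2.2) := by fun_prop
  have h1 : ∀ᵐ t ∂(π.map (fun p => p.2.2)), t ∈ Set.Ioo 0 t_f := by
    rw [ae_iff]
    refine le_antisymm ((h _).trans ?_) zero_le
    rw [Measure.smul_apply]
    have : ∀ᵐ t ∂(volume.restrict (Set.Icc 0 t_f)), t ∈ Set.Ioo 0 t_f := by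
      rw [← Measure.restrict_congr_set (Ioo_ae_eq_Icc (μ := volume) (a := (0:ℝ)) (b := t_f))]
      exact ae_restrict_mem measurableSet_Ioo
    rw [ae_iff.1 this]; simp
  exact ae_of_ae_map hm.aemeasurable h1

lemma toll_cost_eq {r t_f : ℝ} (π : Measure (ℝ × ℝ × ℝ))
    (h : π.map (fun p => p.2.2) ≤ ENNReal.ofReal r • volume.restrict (Set.Icc 0 t_f)) :
    ∫⁻ p, (ENNReal.ofReal (p.1 ^ 2) / ENNReal.ofReal p.2.2
      + ENNReal.ofReal (p.2.1 ^ 2) / ENNReal.ofReal (t_f - p.2.2)) ∂π =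
    ∫⁻ p, (ENNReal.ofReal (p.1 ^ 2) * ENNReal.ofReal (p.2.2)⁻¹
      + ENNReal.ofReal (p.2.1 ^ 2) * ENNReal.ofReal (t_f - p.2.2)⁻¹) ∂π := by
  refine lintegral_congr_ae ?_
  filter_upwards [toll_t_ae π h] with p hp
  rw [ENNReal.ofReal_inv_of_pos hp.1, ENNReal.ofReal_inv_of_pos (by linarith [hp.2]),
    div_eq_mul_inv, div_eq_mul_inv]

lemma toll_split {t_f : ℝ} {X Y τ : ℝ → ℝ} (hX : Measurable X) (hτ : Measurable τ) :
    TollJ t_f X Y τ =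
      (∫⁻ u in Set.Ioo (0:ℝ) 1, ENNReal.ofReal (X u ^ 2) * ENNReal.ofReal (τ u)⁻¹) +
      ∫⁻ u in Set.Ioo (0:ℝ) 1, ENNReal.ofReal (t_f - τ u)⁻¹ * ENNReal.ofReal (Y u ^ 2) := by
  unfold TollJ
  rw [lintegral_add_left (by fun_prop)]
  simp_rw [mul_comm]

lemma toll_compare {M r t_f : ℝ} (hr : 0 < r) {X Y τ : ℝ → ℝ}
    (hX : Antitone X) (hY : Antitone Y)
    (hXb : ∀ u, X u ∈ Set.Icc (-M) 0) (hYb : ∀ u, Y u ∈ Set.Icc 0 M)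
    (hX0 : ∀ᵐ u ∂(volume.restrict (Set.Ioo (0:ℝ) 1)), X u ≠ 0)
    (hY0 : ∀ᵐ u ∂(volume.restrict (Set.Ioo (0:ℝ) 1)), Y u ≠ 0)
    (hτ : τ ∈ TollK r t_f)
    (π : Measure (ℝ × ℝ × ℝ)) [IsProbabilityMeasure π]
    (h1 : π.map Prod.fst = (volume.restrict (Set.Ioo (0:ℝ) 1)).map X)
    (h2 : π.map (fun p => p.2.1) = (volume.restrict (Set.Ioo (0:ℝ) 1)).map Y)
    (h3 : π.map (fun p => p.2.2) = (volume.restrict (Set.Ioo (0:ℝ) 1)).map τ) :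
    TollJ t_f X Y τ ≤ ∫⁻ p, (ENNReal.ofReal (p.1 ^ 2) * ENNReal.ofReal (p.2.2)⁻¹
      + ENNReal.ofReal (p.2.1 ^ 2) * ENNReal.ofReal (t_f - p.2.2)⁻¹) ∂π ∧
    (∫⁻ p, (ENNReal.ofReal (p.1 ^ 2) * ENNReal.ofReal (p.2.2)⁻¹
      + ENNReal.ofReal (p.2.1 ^ 2) * ENNReal.ofReal (t_f - p.2.2)⁻¹) ∂π ≤ TollJ t_f X Y τ →
      TollJ t_f X Y τ ≠ ∞ →
      π.map (fun p => (p.1 ^ 2, (p.2.2)⁻¹)) =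
        (volume.restrict (Set.Ioo (0:ℝ) 1)).map (fun u => (X u ^ 2, (τ u)⁻¹)) ∧
      π.map (fun p => ((t_f - p.2.2)⁻¹, p.2.1 ^ 2)) =
        (volume.restrict (Set.Ioo (0:ℝ) 1)).map (fun u => ((t_f - τ u)⁻¹, Y u ^ 2))) := by
  have mX := hX.measurable
  have mY := hY.measurable
  have mτ : Measurable τ := hτ.1.measurable
  have hmem : ∀ᵐ u ∂(volume.restrict (Set.Ioo (0:ℝ) 1)), u ∈ Set.Ioo (0:ℝ) 1 :=
    ae_restrict_mem measurableSet_Ioo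
  -- transport of a law under a measurable function
  have hlaw : ∀ (f : ℝ × ℝ × ℝ → ℝ) (F : ℝ → ℝ) (g : ℝ → ℝ), Measurable f → Measurable F →
      Measurable g → π.map f = (volume.restrict (Set.Ioo (0:ℝ) 1)).map F →
      π.map (fun p => g (f p)) = (volume.restrict (Set.Ioo (0:ℝ) 1)).map (fun u => g (F u)) := by
    intro f F g hf hF hg h
    have e1 : π.map (fun p => g (f p)) = (π.map f).map g := (Measure.map_map hg hf).symm
    have e2 : (volume.restrict (Set.Ioo (0:ℝ) 1)).map (fun u => g (F u)) =
      ((volume.restrict (Set.Ioo (0:ℝ) 1)).map F).map g := (Measure.map_map hg hF).symm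
    rw [e1, e2, h]
  have c1 := toll_cmp π (fun p => p.1 ^ 2) (fun p => (p.2.2)⁻¹) (by fun_prop) (by fun_prop)
    (fun u => X u ^ 2) (fun u => (τ u)⁻¹) (by fun_prop) (by fun_prop)
    (fun u _ v _ huv => by
      have := hX huv; have := (hXb u).2
      simp only; nlinarith)
    (fun u hu v hv huv => inv_anti₀ (tollK_pos hr hτ hu).1 (hτ.1 huv))
    (by filter_upwards [hX0] with u hu; positivity)
    (by filter_upwards [hmem] with u hu; exact inv_pos.2 (tollK_pos hr hτ hu).1)
    (hlaw _ _ (fun x => x ^ 2) measurable_fst mX (by fun_prop) h1)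
    (hlaw _ _ (fun x => x⁻¹) (by fun_prop) mτ (by fun_prop) h3)
  have c2 := toll_cmp π (fun p => (t_f - p.2.2)⁻¹) (fun p => p.2.1 ^ 2) (by fun_prop) (by fun_prop)
    (fun u => (t_f - τ u)⁻¹) (fun u => Y u ^ 2) (by fun_prop) (by fun_prop)
    (fun u hu v hv huv => inv_anti₀ (by linarith [(tollK_pos hr hτ hv).2])
      (by linarith [hτ.1 huv]))
    (fun u _ v _ huv => by
      have := hY huv; have := (hYb v).1
      simp only; nlinarith)
    (by filter_upwards [hmem] with u hu; exact inv_pos.2 (by linarith [(tollK_pos hr hτ hu).2]))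
    (by filter_upwards [hY0] with u hu; positivity)
    (hlaw _ _ (fun x => (t_f - x)⁻¹) (by fun_prop) mτ (by fun_prop) h3)
    (hlaw _ _ (fun x => x ^ 2) (by fun_prop) mY (by fun_prop) h2)
  have hs : ∫⁻ p, (ENNReal.ofReal (p.1 ^ 2) * ENNReal.ofReal (p.2.2)⁻¹
      + ENNReal.ofReal (p.2.1 ^ 2) * ENNReal.ofReal (t_f - p.2.2)⁻¹) ∂π =
      (∫⁻ p, ENNReal.ofReal (p.1 ^ 2) * ENNReal.ofReal (p.2.2)⁻¹ ∂π) +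
      ∫⁻ p, ENNReal.ofReal (t_f - p.2.2)⁻¹ * ENNReal.ofReal (p.2.1 ^ 2) ∂π := by
    rw [lintegral_add_left (by fun_prop)]
    congr 1
    exact lintegral_congr fun p => mul_comm _ _
  rw [hs, toll_split mX mτ]
  refine ⟨add_le_add c1.1 c2.1, fun hle hfin => ?_⟩
  obtain ⟨n1, n2⟩ := ENNReal.add_ne_top.1 hfin
  constructor
  · refine c1.2 ?_ n1
    refine (ENNReal.add_le_add_iff_right n2).1 (le_trans ?_ hle)
    exact add_le_add le_rfl c2.1
  · refine c2.2 ?_ n2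
    refine (ENNReal.add_le_add_iff_left n1).1 (le_trans ?_ hle)
    exact add_le_add c1.1 le_rfl

theorem stmt_12 (M r t_f : ℝ) (hM : 0 < M) (hr : 0 < r) (htf : 0 < t_f)
    (hrtf : 1 < r * t_f)
    (μ ν : Measure ℝ) [IsProbabilityMeasure μ] [IsProbabilityMeasure ν]
    (hμ : μ (Set.Ioo (-M) 0)ᶜ = 0) (hν : ν (Set.Ioo 0 M)ᶜ = 0)
    (Plans : Set (Measure (ℝ × ℝ × ℝ)))
    (hPlans : Plans = {π | IsProbabilityMeasure π ∧
      π.map Prod.fst = μ ∧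
      π.map (fun p => p.2.1) = ν ∧
      π.map (fun p => p.2.2) ≤ ENNReal.ofReal r • volume.restrict (Set.Icc 0 t_f)})
    (J : Measure (ℝ × ℝ × ℝ) → ℝ≥0∞)
    (hJ : J = fun π => ∫⁻ p, (ENNReal.ofReal (p.1 ^ 2) / ENNReal.ofReal p.2.2
      + ENNReal.ofReal (p.2.1 ^ 2) / ENNReal.ofReal (t_f - p.2.2)) ∂π) :
    ∃ π ∈ Plans, (∀ π' ∈ Plans, J π ≤ J π') ∧
      (∀ π' ∈ Plans, (∀ π'' ∈ Plans, J π' ≤ J π'') → π' = π) ∧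
      ∃ (Tx Ty : ℝ → ℝ) (σ : ℝ → ℝ), Antitone Tx ∧ Antitone Ty ∧
        (∀ t, 0 ≤ σ t ∧ σ t ≤ r) ∧
        π = ((volume.restrict (Set.Icc 0 t_f)).withDensity
              (fun t => ENNReal.ofReal (σ t))).map (fun t => (Tx t, Ty t, t)) := by
  have hprob : IsProbabilityMeasure (volume.restrict (Set.Ioo (0:ℝ) 1)) := ⟨by simp⟩
  obtain ⟨X, hXa, hXb, hXl⟩ := toll_quantile' μ (-M) 0 (by linarith)
    (measure_mono_null (Set.compl_subset_compl.2 Set.Ioo_subset_Icc_self) hμ)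
  obtain ⟨Y, hYa, hYb, hYl⟩ := toll_quantile' ν 0 M hM.le
    (measure_mono_null (Set.compl_subset_compl.2 Set.Ioo_subset_Icc_self) hν)
  have mX := hXa.measurable
  have mY := hYa.measurable
  have hX0 : ∀ᵐ u ∂(volume.restrict (Set.Ioo (0:ℝ) 1)), X u ≠ 0 := by
    have : ∀ᵐ x ∂((volume.restrict (Set.Ioo (0:ℝ) 1)).map X), x ∈ Set.Ioo (-M) 0 := by
      rw [hXl]; exact hμ
    filter_upwards [ae_of_ae_map mX.aemeasurable this] with u hu
    exact hu.2.ne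
  have hY0 : ∀ᵐ u ∂(volume.restrict (Set.Ioo (0:ℝ) 1)), Y u ≠ 0 := by
    have : ∀ᵐ x ∂((volume.restrict (Set.Ioo (0:ℝ) 1)).map Y), x ∈ Set.Ioo 0 M := by
      rw [hYl]; exact hν
    filter_upwards [ae_of_ae_map mY.aemeasurable this] with u hu
    exact hu.1.ne'
  have hXM : ∀ u, X u ^ 2 ≤ M ^ 2 := fun u => by
    have := hXb u; nlinarith [this.1, this.2]
  have hYM : ∀ u, Y u ^ 2 ≤ M ^ 2 := fun u => by
    have := hYb u; nlinarith [this.1, this.2]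
  obtain ⟨τ, hτ, hτmin, hτfin⟩ := toll_exists (M := M) hr htf hrtf mX mY hX0 hXM hYM
  have mτ : Measurable τ := hτ.1.measurable
  obtain ⟨Tx, hTx, hTxe⟩ := toll_T hr hτ hXa hXb
  obtain ⟨Ty, hTy, hTye⟩ := toll_T hr hτ hYa hYb
  have mTx := hTx.measurable
  have mTy := hTy.measurable
  have hmem : ∀ᵐ u ∂(volume.restrict (Set.Ioo (0:ℝ) 1)), u ∈ Set.Ioo (0:ℝ) 1 :=
    ae_restrict_mem measurableSet_Ioo
  set ρ := (volume.restrict (Set.Ioo (0:ℝ) 1)).map τ with hρ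
  have hρle := toll_law_le hr hτ
  have hρp : IsProbabilityMeasure ρ := Measure.isProbabilityMeasure_map mτ.aemeasurable
  have mG : Measurable (fun t : ℝ => (Tx t, Ty t, t)) := by fun_prop
  set π := ρ.map (fun t => (Tx t, Ty t, t)) with hπ
  have hπp : IsProbabilityMeasure π := Measure.isProbabilityMeasure_map mG.aemeasurable
  have hπ1 : π.map Prod.fst = μ := by
    rw [hπ, Measure.map_map measurable_fst mG, hρ, Measure.map_map (by fun_prop) mτ, ← hXl]
    refine Measure.map_congr ?_
    filter_upwards [hmem] with u hu
    exact hTxe u hu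
  have hπ2 : π.map (fun p => p.2.1) = ν := by
    rw [hπ, Measure.map_map (by fun_prop) mG, hρ, Measure.map_map (by fun_prop) mτ, ← hYl]
    refine Measure.map_congr ?_
    filter_upwards [hmem] with u hu
    exact hTye u hu
  have hπ3 : π.map (fun p => p.2.2) = ρ := by
    rw [hπ, Measure.map_map (by fun_prop) mG]
    exact Measure.map_id
  have hπle : π.map (fun p => p.2.2) ≤ ENNReal.ofReal r • volume.restrict (Set.Icc 0 t_f) := by
    rw [hπ3]; exact hρle
  have hJπ : J π = TollJ t_f X Y τ := by
    rw [hJ]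
    simp only
    rw [toll_cost_eq π hπle, hπ, lintegral_map (by fun_prop) mG, hρ,
      lintegral_map (by fun_prop) mτ]
    refine lintegral_congr_ae ?_
    filter_upwards [hmem] with u hu
    simp only [hTxe u hu, hTye u hu]
  subst hPlans
  -- every plan is at least as costly as its monotone rearrangement
  have hlow : ∀ π' : Measure (ℝ × ℝ × ℝ), π' ∈ {π : Measure (ℝ × ℝ × ℝ) | IsProbabilityMeasure π ∧
      π.map Prod.fst = μ ∧ π.map (fun p => p.2.1) = ν ∧
      π.map (fun p => p.2.2) ≤ ENNReal.ofReal r • volume.restrict (Set.Icc 0 t_f)} →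
      J π ≤ J π' ∧ (J π' ≤ J π → π' = π) := by
    rintro π' ⟨hp, q1, q2, q3⟩
    have m3 : Measurable (fun p : ℝ × ℝ × ℝ => p.2.2) := by fun_prop
    have hp3 : IsProbabilityMeasure (π'.map (fun p => p.2.2)) :=
      Measure.isProbabilityMeasure_map m3.aemeasurable
    obtain ⟨τ', hτ', hτl⟩ := toll_law_ge hr htf _ q3
    have mτ' : Measurable τ' := hτ'.1.measurable
    obtain ⟨k1, k2⟩ := toll_compare hr hXa hYa hXb hYb hX0 hY0 hτ' π'
      (q1.trans hXl.symm) (q2.trans hYl.symm) hτl.symm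
    have hJπ' := toll_cost_eq π' q3
    have hJe : J π' = ∫⁻ p, (ENNReal.ofReal (p.1 ^ 2) * ENNReal.ofReal (p.2.2)⁻¹
      + ENNReal.ofReal (p.2.1 ^ 2) * ENNReal.ofReal (t_f - p.2.2)⁻¹) ∂π' := by
      rw [hJ]; exact hJπ'
    rw [← hJe] at k1 k2
    rw [hJπ]
    refine ⟨(hτmin τ' hτ').trans k1, fun hle => ?_⟩
    have hττ : τ =ᵐ[volume.restrict (Set.Ioo (0:ℝ) 1)] τ' :=
      toll_unique hr htf mX mY hX0 hτ hτ' hτmin (k1.trans hle) hτfin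
    have hfin' : TollJ t_f X Y τ' ≠ ∞ := ne_top_of_le_ne_top hτfin (k1.trans hle)
    obtain ⟨l1, l2⟩ := k2 (hle.trans (hτmin τ' hτ')) hfin'
    have a1 : ∀ᵐ p ∂π', p.1 = Tx p.2.2 := by
      have b1 : ∀ᵐ p ∂π', p.1 ∈ Set.Ioo (-M) 0 := by
        refine ae_of_ae_map measurable_fst.aemeasurable (p := fun x => x ∈ Set.Ioo (-M) 0) ?_
        rw [q1]; exact hμ
      have b2 : ∀ᵐ z ∂(π'.map (fun p => (p.1 ^ 2, (p.2.2)⁻¹))),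
          -Real.sqrt z.1 = Tx (z.2)⁻¹ := by
        rw [l1, ae_map_iff (by fun_prop) (measurableSet_eq_fun (by fun_prop) (by fun_prop))]
        filter_upwards [hmem, hττ] with u hu hu'
        simp only [inv_inv]
        rw [← hu', hTxe u hu, Real.sqrt_sq_eq_abs, abs_of_nonpos (hXb u).2, neg_neg]
      have b3 := ae_of_ae_map (by fun_prop) b2
      filter_upwards [b1, b3] with p hp1 hp2
      simp only [inv_inv] at hp2
      rw [← hp2, Real.sqrt_sq_eq_abs, abs_of_nonpos hp1.2.le, neg_neg]
    have a2 : ∀ᵐ p ∂π', p.2.1 = Ty p.2.2 := by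
      have b1 : ∀ᵐ p ∂π', p.2.1 ∈ Set.Ioo 0 M := by
        refine ae_of_ae_map (f := fun p : ℝ × ℝ × ℝ => p.2.1) (by fun_prop)
          (p := fun x => x ∈ Set.Ioo 0 M) ?_
        rw [q2]; exact hν
      have b2 : ∀ᵐ z ∂(π'.map (fun p => ((t_f - p.2.2)⁻¹, p.2.1 ^ 2))),
          Real.sqrt z.2 = Ty (t_f - (z.1)⁻¹) := by
        rw [l2, ae_map_iff (by fun_prop) (measurableSet_eq_fun (by fun_prop) (by fun_prop))]
        filter_upwards [hmem, hττ] with u hu hu'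
        simp only [inv_inv, _root_.sub_sub_cancel]
        rw [← hu', hTye u hu, Real.sqrt_sq_eq_abs, abs_of_nonneg (hYb u).1]
      have b3 := ae_of_ae_map (by fun_prop) b2
      filter_upwards [b1, b3] with p hp1 hp2
      simp only [inv_inv, _root_.sub_sub_cancel] at hp2
      rw [← hp2, Real.sqrt_sq_eq_abs, abs_of_nonneg hp1.1.le]
    have e1 : ρ = π'.map (fun p => p.2.2) := by
      rw [← hτl, hρ]; exact Measure.map_congr hττ
    rw [hπ, e1, Measure.map_map mG m3]
    conv_lhs => rw [← Measure.map_id (μ := π')]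
    refine Measure.map_congr ?_
    filter_upwards [a1, a2] with p hp1 hp2
    simp only [id, Function.comp]
    rw [← hp1, ← hp2]
  have hmemπ : π ∈ {π : Measure (ℝ × ℝ × ℝ) | IsProbabilityMeasure π ∧
      π.map Prod.fst = μ ∧ π.map (fun p => p.2.1) = ν ∧
      π.map (fun p => p.2.2) ≤ ENNReal.ofReal r • volume.restrict (Set.Icc 0 t_f)} :=
    ⟨hπp, hπ1, hπ2, hπle⟩
  obtain ⟨σ, hσ, hσρ⟩ := toll_density hr ρ hρle
  refine ⟨π, hmemπ, fun π' h => (hlow π' h).1, fun π' h h' => (hlow π' h).2 (h' π hmemπ),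
    Tx, Ty, σ, hTx, hTy, hσ, ?_⟩
  rw [← hσρ]
end

section
/- Let r be a nonnegative integrable function on [0, t_f] with ∫₀^{t_f} r(t) dt > 1, and let μ, ν be compactly supported probability measures on ℝⁿ. Then the set of probability measures π on ℝⁿ × ℝⁿ × [0, t_f] with marginals μ, ν and t-marginal ≤ r(t)dt is nonempty and weakly compact, and the minimum of ∫(‖ξ−x‖²/t + ‖y−ξ‖²/(t_f−t))dπ is attained provided the constraint set contains a plan of finite cost. -/
open MeasureTheory ENNReal

open Filter Topology in
lemma aux_closed_le (ρ : Measure ℝ) [IsFiniteMeasure ρ] :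
    IsClosed {π : ProbabilityMeasure ℝ | (π : Measure ℝ) ≤ ρ} := by
  apply isClosed_of_closure_subset
  intro π hπ
  rw [mem_closure_iff_clusterPt] at hπ
  have hne : (𝓝 π ⊓ 𝓟 {π : ProbabilityMeasure ℝ | (π : Measure ℝ) ≤ ρ}).NeBot := hπ
  have key : ∀ G : Set ℝ, IsOpen G → (π : Measure ℝ) G ≤ ρ G := by
    intro G hG
    have h1 := ProbabilityMeasure.le_liminf_measure_open_of_tendsto
      (L := 𝓝 π ⊓ 𝓟 {π : ProbabilityMeasure ℝ | (π : Measure ℝ) ≤ ρ})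
      (μs := id) (μ := π) (tendsto_id.mono_left inf_le_left) hG
    refine h1.trans (liminf_le_of_frequently_le' (Eventually.frequently ?_))
    refine Eventually.filter_mono inf_le_right ?_
    rw [eventually_principal]
    intro π' hπ'
    exact hπ' G
  show (π : Measure ℝ) ≤ ρ
  rw [Measure.le_iff]
  intro A _
  refine le_of_forall_gt fun c hc => ?_
  obtain ⟨U, hAU, hU, hlt⟩ := A.exists_isOpen_lt_of_lt c hc
  exact ((measure_mono hAU).trans (key U hU)).trans_lt hlt

noncomputable def auxH (a s : NNReal) (k : ℕ) : NNReal :=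
  min (a / (s + ((k : NNReal) + 1)⁻¹)) k

lemma auxH_coe (a s : NNReal) (k : ℕ) :
    (auxH a s k : ℝ≥0∞) = min ((a : ℝ≥0∞) / (s + ((k : ℝ≥0∞) + 1)⁻¹)) k := by
  unfold auxH
  have h1 : ((k : NNReal) + 1) ≠ 0 := by positivity
  have h2 : s + ((k : NNReal) + 1)⁻¹ ≠ 0 := by positivity
  rw [ENNReal.coe_min, ENNReal.coe_div h2, ENNReal.coe_add, ENNReal.coe_inv h1]
  simp

lemma auxH_mono (a s : NNReal) : Monotone fun k : ℕ => (auxH a s k : ℝ≥0∞) := by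
  intro i j hij
  simp only [auxH_coe]
  gcongr

open Filter Topology in
lemma auxH_iSup (a s : NNReal) : ⨆ k, (auxH a s k : ℝ≥0∞) = (a : ℝ≥0∞) / s := by
  by_cases ha : a = 0
  · subst ha; simp [auxH_coe]
  refine le_antisymm (iSup_le fun k => ?_) ?_
  · rw [auxH_coe]
    refine (min_le_left _ _).trans ?_
    gcongr
    exact le_self_add
  · have h1 : Tendsto (fun k : ℕ => ((k : ℝ≥0∞) + 1)⁻¹) atTop (𝓝 0) := by
      have := (tendsto_add_atTop_iff_nat 1).2 ENNReal.tendsto_inv_nat_nhds_zero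
      simpa using this
    have h2 : Tendsto (fun k : ℕ => (s : ℝ≥0∞) + ((k : ℝ≥0∞) + 1)⁻¹) atTop (𝓝 (s : ℝ≥0∞)) := by
      simpa using h1.const_add (s : ℝ≥0∞)
    have h3 : Tendsto (fun k : ℕ => (a : ℝ≥0∞) / (s + ((k : ℝ≥0∞) + 1)⁻¹)) atTop
        (𝓝 ((a : ℝ≥0∞) / s)) := by
      apply ENNReal.Tendsto.div tendsto_const_nhds _ h2
      · left; simp
      · left; simpa using ha
    have h4 := h3.min ENNReal.tendsto_nat_nhds_top
    rw [min_eq_left le_top] at h4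
    refine le_of_tendsto' h4 fun k => ?_
    rw [← auxH_coe]
    exact le_iSup (fun k => (auxH a s k : ℝ≥0∞)) k

lemma aux_lsc {X : Type*} [TopologicalSpace X] [MeasurableSpace X] [OpensMeasurableSpace X]
    (a s : X → NNReal) (ha : Continuous a) (hs : Continuous s) :
    LowerSemicontinuous fun π : ProbabilityMeasure X =>
      ∫⁻ p, (a p : ℝ≥0∞) / (s p : ℝ≥0∞) ∂(π : Measure X) := by
  have hc : ∀ k, Continuous fun p => auxH (a p) (s p) k := by
    intro k
    unfold auxH
    refine Continuous.min (ha.div (by fun_prop) fun p => ?_) continuous_const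
    positivity
  have : (fun π : ProbabilityMeasure X =>
      ∫⁻ p, (a p : ℝ≥0∞) / (s p : ℝ≥0∞) ∂(π : Measure X)) =
      fun π : ProbabilityMeasure X => ⨆ k, ∫⁻ p, (auxH (a p) (s p) k : ℝ≥0∞) ∂(π : Measure X) := by
    funext π
    rw [← lintegral_iSup]
    · simp only [auxH_iSup]
    · intro k
      exact (hc k).measurable.coe_nnreal_ennreal
    · intro i j hij p
      exact auxH_mono _ _ hij
  rw [this]
  refine lowerSemicontinuous_iSup fun k => Continuous.lowerSemicontinuous ?_
  have hb : ∀ x y, dist (auxH (a x) (s x) k) (auxH (a y) (s y) k) ≤ k := by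
    intro x y
    have hx : (auxH (a x) (s x) k : ℝ) ≤ k := by exact_mod_cast min_le_right _ _
    have hy : (auxH (a y) (s y) k : ℝ) ≤ k := by exact_mod_cast min_le_right _ _
    have hx0 := (auxH (a x) (s x) k).2
    have hy0 := (auxH (a y) (s y) k).2
    rw [NNReal.dist_eq, abs_le]
    constructor <;> simp at * <;> linarith
  let f : BoundedContinuousFunction X NNReal :=
    BoundedContinuousFunction.mkOfBound ⟨_, hc k⟩ k hb
  have h1 := ProbabilityMeasure.continuous_testAgainstNN_eval f
  have h2 := ENNReal.continuous_coe.comp h1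
  convert h2 using 2 with π
  simp only [Function.comp, FiniteMeasure.testAgainstNN_coe_eq]
  rfl

theorem stmt_18 (n : ℕ) (μ ν : Measure (EuclideanSpace ℝ (Fin n)))
    [IsProbabilityMeasure μ] [IsProbabilityMeasure ν]
    (hμ : ∃ K, IsCompact K ∧ μ Kᶜ = 0) (hν : ∃ K, IsCompact K ∧ ν Kᶜ = 0)
    (ξ : EuclideanSpace ℝ (Fin n)) (t_f : ℝ) (htf : 0 < t_f)
    (r : ℝ → ℝ) (hr0 : ∀ t, 0 ≤ r t) (hrint : IntegrableOn r (Set.Icc 0 t_f))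
    (hrtot : 1 < ∫ t in Set.Icc (0 : ℝ) t_f, r t)
    (Plans : Set (ProbabilityMeasure (EuclideanSpace ℝ (Fin n) × EuclideanSpace ℝ (Fin n) × ℝ)))
    (hPlans : Plans = {π : ProbabilityMeasure (EuclideanSpace ℝ (Fin n) × EuclideanSpace ℝ (Fin n) × ℝ) |
      (π : Measure (EuclideanSpace ℝ (Fin n) × EuclideanSpace ℝ (Fin n) × ℝ)).map Prod.fst = μ ∧
      (π : Measure (EuclideanSpace ℝ (Fin n) × EuclideanSpace ℝ (Fin n) × ℝ)).map
        (fun p => p.2.1) = ν ∧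
      (π : Measure (EuclideanSpace ℝ (Fin n) × EuclideanSpace ℝ (Fin n) × ℝ)).map
        (fun p => p.2.2) ≤
        (volume.restrict (Set.Icc 0 t_f)).withDensity (fun t => ENNReal.ofReal (r t))})
    (J : ProbabilityMeasure (EuclideanSpace ℝ (Fin n) × EuclideanSpace ℝ (Fin n) × ℝ) → ℝ≥0∞)
    (hJ : J = fun π : ProbabilityMeasure (EuclideanSpace ℝ (Fin n) × EuclideanSpace ℝ (Fin n) × ℝ) => ∫⁻ p, (ENNReal.ofReal (‖ξ - p.1‖ ^ 2) / ENNReal.ofReal p.2.2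
      + ENNReal.ofReal (‖p.2.1 - ξ‖ ^ 2) / ENNReal.ofReal (t_f - p.2.2))
      ∂(π : Measure (EuclideanSpace ℝ (Fin n) × EuclideanSpace ℝ (Fin n) × ℝ))) :
    Plans.Nonempty ∧ IsCompact Plans ∧
      ((∃ π ∈ Plans, J π < ⊤) → ∃ π ∈ Plans, ∀ π' ∈ Plans, J π ≤ J π') := by

  set ρ : Measure ℝ :=
    (volume.restrict (Set.Icc 0 t_f)).withDensity (fun t => ENNReal.ofReal (r t)) with hρ
  have hρuniv : ρ Set.univ = ENNReal.ofReal (∫ t in Set.Icc (0 : ℝ) t_f, r t) := by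
    rw [hρ, withDensity_apply _ MeasurableSet.univ, Measure.restrict_univ,
      ofReal_integral_eq_lintegral_ofReal hrint (Filter.Eventually.of_forall hr0)]
  have hρfin : IsFiniteMeasure ρ := ⟨by rw [hρuniv]; exact ENNReal.ofReal_lt_top⟩
  have hρ1 : 1 ≤ ρ Set.univ := by
    rw [hρuniv]; exact ENNReal.one_le_ofReal.2 hrtot.le
  have hρc : ρ (Set.Icc 0 t_f)ᶜ = 0 := by
    have h : ρ ≪ volume.restrict (Set.Icc 0 t_f) := withDensity_absolutelyContinuous _ _
    apply h
    rw [Measure.restrict_apply measurableSet_Icc.compl]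
    simp
  have hm1 : Measurable (Prod.fst : EuclideanSpace ℝ (Fin n) × EuclideanSpace ℝ (Fin n) × ℝ → EuclideanSpace ℝ (Fin n)) := measurable_fst
  have hm2 : Measurable (fun p : EuclideanSpace ℝ (Fin n) × EuclideanSpace ℝ (Fin n) × ℝ => p.2.1) := by fun_prop
  have hm3 : Measurable (fun p : EuclideanSpace ℝ (Fin n) × EuclideanSpace ℝ (Fin n) × ℝ => p.2.2) := by fun_prop
  have hc1 : Continuous (Prod.fst : EuclideanSpace ℝ (Fin n) × EuclideanSpace ℝ (Fin n) × ℝ → EuclideanSpace ℝ (Fin n)) := continuous_fst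
  have hc2 : Continuous (fun p : EuclideanSpace ℝ (Fin n) × EuclideanSpace ℝ (Fin n) × ℝ => p.2.1) := by fun_prop
  have hc3 : Continuous (fun p : EuclideanSpace ℝ (Fin n) × EuclideanSpace ℝ (Fin n) × ℝ => p.2.2) := by fun_prop
  -- nonempty
  have hne : Plans.Nonempty := by
    have hρ0 : ρ Set.univ ≠ 0 := (lt_of_lt_of_le zero_lt_one hρ1).ne'
    have : IsProbabilityMeasure ((ρ Set.univ)⁻¹ • ρ) := ⟨by
      rw [Measure.smul_apply, smul_eq_mul]
      exact ENNReal.inv_mul_cancel hρ0 (measure_ne_top _ _)⟩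
    refine ⟨⟨μ.prod (ν.prod ((ρ Set.univ)⁻¹ • ρ)), inferInstance⟩, ?_⟩
    rw [hPlans]
    refine ⟨?_, ?_, ?_⟩
    · simp [ProbabilityMeasure.coe_mk, Measure.map_fst_prod]
    · have h : (fun p : EuclideanSpace ℝ (Fin n) × EuclideanSpace ℝ (Fin n) × ℝ => p.2.1) = Prod.fst ∘ Prod.snd := rfl
      rw [ProbabilityMeasure.coe_mk, h, ← Measure.map_map measurable_fst measurable_snd,
        Measure.map_snd_prod, measure_univ, one_smul, Measure.map_fst_prod, measure_univ, one_smul]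
    · have h : (fun p : EuclideanSpace ℝ (Fin n) × EuclideanSpace ℝ (Fin n) × ℝ => p.2.2) = Prod.snd ∘ Prod.snd := rfl
      rw [ProbabilityMeasure.coe_mk, h, ← Measure.map_map measurable_snd measurable_snd,
        Measure.map_snd_prod, measure_univ, one_smul, Measure.map_snd_prod, measure_univ, one_smul]
      rw [Measure.le_iff]
      intro A _
      rw [Measure.smul_apply, smul_eq_mul]
      calc _ ≤ 1 * ρ A := by
            gcongr
            exact ENNReal.inv_le_one.2 hρ1
        _ = ρ A := one_mul _
  -- closed
  have hclosed : IsClosed Plans := by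
    have e : Plans =
        ((fun π : ProbabilityMeasure (EuclideanSpace ℝ (Fin n) × EuclideanSpace ℝ (Fin n) × ℝ) => π.map hc1.measurable.aemeasurable) ⁻¹'
          {(⟨μ, inferInstance⟩ : ProbabilityMeasure (EuclideanSpace ℝ (Fin n)))}) ∩
        (((fun π : ProbabilityMeasure (EuclideanSpace ℝ (Fin n) × EuclideanSpace ℝ (Fin n) × ℝ) => π.map hc2.measurable.aemeasurable) ⁻¹'
          {(⟨ν, inferInstance⟩ : ProbabilityMeasure (EuclideanSpace ℝ (Fin n)))}) ∩
        ((fun π : ProbabilityMeasure (EuclideanSpace ℝ (Fin n) × EuclideanSpace ℝ (Fin n) × ℝ) => π.map hc3.measurable.aemeasurable) ⁻¹'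
          {π : ProbabilityMeasure ℝ | (π : Measure ℝ) ≤ ρ})) := by
      rw [hPlans]
      ext π
      constructor
      · rintro ⟨h1, h2, h3⟩
        exact ⟨Set.mem_singleton_iff.2 (Subtype.ext h1),
          Set.mem_singleton_iff.2 (Subtype.ext h2), h3⟩
      · rintro ⟨h1, h2, h3⟩
        exact ⟨congrArg Subtype.val (Set.mem_singleton_iff.1 h1),
          congrArg Subtype.val (Set.mem_singleton_iff.1 h2), h3⟩
    rw [e]
    exact (isClosed_singleton.preimage (ProbabilityMeasure.continuous_map hc1)).inter
      ((isClosed_singleton.preimage (ProbabilityMeasure.continuous_map hc2)).inter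
      ((aux_closed_le ρ).preimage (ProbabilityMeasure.continuous_map hc3)))
  have hcomp : IsCompact Plans := by
    rw [← hclosed.closure_eq]
    apply isCompact_closure_of_isTightMeasureSet
    rw [isTightMeasureSet_iff_exists_isCompact_measure_compl_le]
    intro ε hε
    obtain ⟨K₁, hK₁, hμK⟩ := hμ
    obtain ⟨K₂, hK₂, hνK⟩ := hν
    refine ⟨K₁ ×ˢ (K₂ ×ˢ Set.Icc 0 t_f), hK₁.prod (hK₂.prod isCompact_Icc), ?_⟩
    rintro _ ⟨π, hπ, rfl⟩
    rw [hPlans] at hπ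
    obtain ⟨h1, h2, h3⟩ := hπ
    have e1 : (π : Measure (EuclideanSpace ℝ (Fin n) × EuclideanSpace ℝ (Fin n) × ℝ)) (Prod.fst ⁻¹' K₁ᶜ) = 0 := by
      rw [← Measure.map_apply hm1 hK₁.measurableSet.compl, h1, hμK]
    have e2 : (π : Measure (EuclideanSpace ℝ (Fin n) × EuclideanSpace ℝ (Fin n) × ℝ)) ((fun p : EuclideanSpace ℝ (Fin n) × EuclideanSpace ℝ (Fin n) × ℝ => p.2.1) ⁻¹' K₂ᶜ) = 0 := by
      rw [← Measure.map_apply hm2 hK₂.measurableSet.compl, h2, hνK]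
    have e3 : (π : Measure (EuclideanSpace ℝ (Fin n) × EuclideanSpace ℝ (Fin n) × ℝ)) ((fun p : EuclideanSpace ℝ (Fin n) × EuclideanSpace ℝ (Fin n) × ℝ => p.2.2) ⁻¹' (Set.Icc 0 t_f)ᶜ) = 0 := by
      rw [← Measure.map_apply hm3 measurableSet_Icc.compl]
      exact le_antisymm ((h3 _).trans hρc.le) zero_le
    have e4 := measure_union_null e1 (measure_union_null e2 e3)
    refine (le_of_eq (measure_mono_null ?_ e4)).trans zero_le
    rintro ⟨x, y, t⟩ hp
    simp only [Set.mem_compl_iff, Set.mem_prod, Set.mem_union, Set.mem_preimage] at hp ⊢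
    tauto
  refine ⟨hne, hcomp, fun _ => ?_⟩
  have hlsc : LowerSemicontinuous J := by
    have l1 := aux_lsc (X := EuclideanSpace ℝ (Fin n) × EuclideanSpace ℝ (Fin n) × ℝ) (fun p => Real.toNNReal (‖ξ - p.1‖ ^ 2))
      (fun p => Real.toNNReal p.2.2) (by fun_prop) (by fun_prop)
    have l2 := aux_lsc (X := EuclideanSpace ℝ (Fin n) × EuclideanSpace ℝ (Fin n) × ℝ) (fun p => Real.toNNReal (‖p.2.1 - ξ‖ ^ 2))
      (fun p => Real.toNNReal (t_f - p.2.2)) (by fun_prop) (by fun_prop)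
    have l := l1.add l2
    rw [hJ]
    convert l using 2 with π
    rw [← lintegral_add_left]
    · rfl
    · fun_prop
  obtain ⟨π, hπ, hmin⟩ := (hlsc.lowerSemicontinuousOn Plans).exists_isMinOn hne hcomp
  exact ⟨π, hπ, fun π' hπ' => hmin hπ'⟩
end
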